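/- arXiv:1610.01287 — 2 statements merged into one kernel-verified Lean document; each statement's English description precedes it below -/
import Mathlib

section
/- Fix 0 < p < q ≤ 1/2 and a rate R with 1 − H(q) < R < 1 − H(p), and let N = ⌈2^{nR}⌉. For all sufficiently small ε₁, ε₂, δ > 0 there exist β > 0 and a constant c such that the following holds for all sufficiently large n. Fix any z ∈ {0,1}^n, any integer d with |d − qn| ≤ ε₁·n, any s ∈ {0,1}^n of Hamming weight at most pn, and any subset M of {1,…,N} with 2^{n(H(d/n)+R−1−ε₂)} ≤ |M| ≤ 2^{n(H(d/n)+R−1+ε₂)}. Let the codewords (X^n(w))_{w∈M} be independent and uniform on the Hamming shell Sh(z,d), and let the codewords (X^n(w))_{w∉M} be independent and uniform on {0,1}^n \ Sh(z,d), the two families independent of each other (this is the conditional distribution of an i.i.d.-uniform code given that exactly the messages in M have codewords on Sh(z,d)). Partition M, in increasing order of message value, into consecutive blocks M^{(1)}, …, M^{(λ)} each of size ⌈2^{nδ}⌉, except possibly the last block which may be smaller. Then with probability at least 1 − e^{−β·n²}, for every i < λ there are at most c²·n⁴ messages w ∈ M^{(i)} for which there exists a message w' ∉ M^{(i)} with d_H(X^n(w)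 ⊕ s, X^n(w')) ≤ (p+ε₁)·n. -/
open scoped BigOperators Classical

/-- Binary entropy function (in bits). -/
noncomputable def binH (t : ℝ) : ℝ := -t * Real.logb 2 t - (1 - t) * Real.logb 2 (1 - t)

/-- Hamming weight of a binary vector. -/
def wt {n : ℕ} (s : Fin n → Bool) : ℕ := (Finset.univ.filter fun t => s t = true).card

/-- Coordinatewise XOR of binary vectors. -/
def xorVec {n : ℕ} (x s : Fin n → Bool) : Fin n → Bool := fun t => xor (x t) (s t)

/-- Probability mass of the codebook `C` when the codewords with index in `M` are drawn
independently and uniformly from the Hamming shell `Sh(z,d)` and the remaining codewords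
are drawn independently and uniformly from its complement (this is the conditional
distribution of an i.i.d.-uniform code given that exactly the messages in `M` have
codewords on `Sh(z,d)`). -/
noncomputable def shellCodeProb (n N : ℕ) (M : Finset (Fin N)) (z : Fin n → Bool) (d : ℕ)
    (C : Fin N → Fin n → Bool) : ℝ :=
  ∏ w : Fin N,
    if w ∈ M then
      (if hammingDist (C w) z = d then
        (1 : ℝ) / (Nat.card {x : Fin n → Bool // hammingDist x z = d} : ℝ)
      else 0)
    else
      (if hammingDist (C w) z = d then 0
      else (1 : ℝ) /
        ((2 : ℝ) ^ n - (Nat.card {x : Fin n → Bool // hammingDist x z = d} : ℝ)))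

/-- The rank (0-indexed position in increasing order) of `w` inside the finset `M`. -/
def rankIn {N : ℕ} (M : Finset (Fin N)) (w : Fin N) : ℕ :=
  (M.filter fun w' => w' < w).card

/-- The `k`-th consecutive block (0-indexed) of size `B` in the partition of `M` taken in
increasing order of message value. -/
def blockOf {N : ℕ} (M : Finset (Fin N)) (B k : ℕ) : Finset (Fin N) :=
  M.filter fun w => rankIn M w / B = k

/-- The number of blocks in the partition of `M` into consecutive blocks of size `B`
(the last block possibly smaller). -/
def numBlocks {N : ℕ} (M : Finset (Fin N)) (B : ℕ) : ℕ := (M.card + B - 1) / B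

section ProductExpectation

variable {ι X : Type*} [Fintype ι] [Fintype X]

/-- The expectation of `G` under the product of the mass functions `f w`. -/
noncomputable def prodExp (f : ι → X → ℝ) (G : (ι → X) → ℝ) : ℝ :=
  ∑ C : ι → X, (∏ w, f w (C w)) * G C

theorem prodExp_mono {f : ι → X → ℝ} (hf : ∀ w x, 0 ≤ f w x) {G G' : (ι → X) → ℝ}
    (h : ∀ C, G C ≤ G' C) : prodExp f G ≤ prodExp f G' :=
  Finset.sum_le_sum fun C _ =>
    mul_le_mul_of_nonneg_left (h C) (Finset.prod_nonneg fun w _ => hf w (C w))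

theorem prodExp_add (f : ι → X → ℝ) (G G' : (ι → X) → ℝ) :
    prodExp f (fun C => G C + G' C) = prodExp f G + prodExp f G' := by
  simp only [prodExp, mul_add, Finset.sum_add_distrib]

theorem prodExp_sum {κ : Type*} (S : Finset κ) (f : ι → X → ℝ) (G : κ → (ι → X) → ℝ) :
    prodExp f (fun C => ∑ k ∈ S, G k C) = ∑ k ∈ S, prodExp f (G k) := by
  simp only [prodExp, Finset.mul_sum]
  exact Finset.sum_comm

theorem prodExp_const_mul (f : ι → X → ℝ) (a : ℝ) (G : (ι → X) → ℝ) :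
    prodExp f (fun C => a * G C) = a * prodExp f G := by
  simp only [prodExp, Finset.mul_sum]
  exact Finset.sum_congr rfl fun C _ => by ring

theorem prodExp_prod (f g : ι → X → ℝ) :
    prodExp f (fun C => ∏ w, g w (C w)) = ∏ w, ∑ x, f w x * g w x := by
  simp only [prodExp, ← Finset.prod_mul_distrib]
  rw [Finset.prod_univ_sum, Fintype.piFinset_univ]

theorem prodExp_one {f : ι → X → ℝ} (hf1 : ∀ w, ∑ x, f w x = 1) :
    prodExp f (fun _ => 1) = 1 := by
  have := prodExp_prod f (fun _ _ => (1 : ℝ))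
  simpa [hf1] using this

/-- Resampling one coordinate does not change the expectation. -/
theorem prodExp_resample {f : ι → X → ℝ} (hf1 : ∀ w, ∑ x, f w x = 1) (a : ι)
    (G : (ι → X) → ℝ) :
    prodExp f (fun C => ∑ x, f a x * G (Function.update C a x)) = prodExp f G := by
  have key : ∀ (C : ι → X) (x : X), (∏ w, f w (C w)) * f a x =
      (∏ w, f w (Function.update C a x w)) * f a (C a) := by
    intro C x
    rw [← Finset.mul_prod_erase Finset.univ _ (Finset.mem_univ a),
      ← Finset.mul_prod_erase Finset.univ (fun w => f w (Function.update C a x w))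
        (Finset.mem_univ a)]
    have : ∏ w ∈ Finset.univ.erase a, f w (Function.update C a x w) =
        ∏ w ∈ Finset.univ.erase a, f w (C w) :=
      Finset.prod_congr rfl fun w hw => by
        rw [Function.update_of_ne (Finset.ne_of_mem_erase hw)]
    rw [this, Function.update_self]
    ring
  let e : (ι → X) × X ≃ (ι → X) × X :=
    { toFun := fun c => (Function.update c.1 a c.2, c.1 a)
      invFun := fun c => (Function.update c.1 a c.2, c.1 a)
      left_inv := fun c => by simp
      right_inv := fun c => by simp }
  calc prodExp f (fun C => ∑ x, f a x * G (Function.update C a x))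
      = ∑ c : (ι → X) × X, (∏ w, f w ((e c).1 w)) * f a (e c).2 * G (e c).1 := by
        rw [Fintype.sum_prod_type, prodExp]
        refine Finset.sum_congr rfl fun C _ => ?_
        rw [Finset.mul_sum]
        refine Finset.sum_congr rfl fun x _ => ?_
        rw [← mul_assoc, key]
        rfl
    _ = ∑ c : (ι → X) × X, (∏ w, f w (c.1 w)) * f a c.2 * G c.1 :=
        e.sum_comp fun c => (∏ w, f w (c.1 w)) * f a c.2 * G c.1
    _ = prodExp f G := by
        rw [Fintype.sum_prod_type, prodExp]
        refine Finset.sum_congr rfl fun C _ => ?_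
        dsimp only
        rw [← Finset.sum_mul, ← Finset.mul_sum, hf1, mul_one]

/-- Coordinates in `K` hit a set determined by the other coordinates independently. -/
theorem prodExp_prod_indicator_le {f : ι → X → ℝ} (hf : ∀ w x, 0 ≤ f w x)
    (hf1 : ∀ w, ∑ x, f w x = 1) (K : Finset ι) (A : (ι → X) → Set X)
    (hA : ∀ C C' : ι → X, (∀ w ∉ K, C w = C' w) → A C = A C') {r : ℝ} (hr : 0 ≤ r)
    (hAr : ∀ C, ∀ w ∈ K, ∑ x, f w x * (if x ∈ A C then 1 else 0) ≤ r)
    (U : Finset ι) (hU : U ⊆ K) :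
    prodExp f (fun C => ∏ w ∈ U, if C w ∈ A C then 1 else 0) ≤ r ^ U.card := by
  induction U using Finset.induction_on with
  | empty => simp [prodExp_one hf1]
  | insert a U ha ih =>
    have haK : a ∈ K := hU (Finset.mem_insert_self a U)
    have hUK : U ⊆ K := (Finset.subset_insert a U).trans hU
    rw [← prodExp_resample hf1 a, Finset.card_insert_of_notMem ha, pow_succ']
    refine le_trans ?_ (mul_le_mul_of_nonneg_left (ih hUK) hr)
    rw [← prodExp_const_mul]
    refine prodExp_mono hf fun C => ?_
    have hAu : ∀ x, A (Function.update C a x) = A C := fun x =>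
      hA _ _ fun w hw => Function.update_of_ne (fun h => hw (by rwa [h])) _ _
    have : ∀ x, (∏ w ∈ insert a U, if Function.update C a x w ∈ A (Function.update C a x)
        then (1 : ℝ) else 0) = (if x ∈ A C then 1 else 0) *
          ∏ w ∈ U, if C w ∈ A C then (1 : ℝ) else 0 := by
      intro x
      rw [Finset.prod_insert ha, hAu, Function.update_self]
      congr 1
      refine Finset.prod_congr rfl fun w hw => ?_
      rw [Function.update_of_ne (fun h => ha (by rwa [← h]))]
    simp only [this, ← mul_assoc]
    rw [← Finset.sum_mul]
    refine mul_le_mul_of_nonneg_right (hAr C a haK) (Finset.prod_nonneg fun w _ => ?_)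
    split_ifs <;> norm_num

/-- Tail bound for the number of coordinates in `K` hitting a set determined by the others. -/
theorem prodExp_card_tail_le {f : ι → X → ℝ} (hf : ∀ w x, 0 ≤ f w x)
    (hf1 : ∀ w, ∑ x, f w x = 1) (K : Finset ι) (A : (ι → X) → Set X)
    (hA : ∀ C C' : ι → X, (∀ w ∉ K, C w = C' w) → A C = A C') {r : ℝ} (hr : 0 ≤ r)
    (hAr : ∀ C, ∀ w ∈ K, ∑ x, f w x * (if x ∈ A C then 1 else 0) ≤ r) (T : ℕ) :
    prodExp f (fun C => if T ≤ (K.filter fun w => C w ∈ A C).card then 1 else 0) ≤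
      (K.card * r) ^ T := by
  calc prodExp f (fun C => if T ≤ (K.filter fun w => C w ∈ A C).card then 1 else 0)
      ≤ prodExp f (fun C => ∑ U ∈ K.powersetCard T,
          ∏ w ∈ U, if C w ∈ A C then (1 : ℝ) else 0) := by
        refine prodExp_mono hf fun C => ?_
        have hnn : ∀ U ∈ K.powersetCard T,
            0 ≤ ∏ w ∈ U, if C w ∈ A C then (1 : ℝ) else 0 := fun U _ =>
          Finset.prod_nonneg fun w _ => by split_ifs <;> norm_num
        split_ifs with h
        · obtain ⟨U, hU, hUT⟩ := Finset.exists_subset_card_eq h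
          have hmem : U ∈ K.powersetCard T :=
            Finset.mem_powersetCard.2 ⟨hU.trans (Finset.filter_subset _ _), hUT⟩
          refine le_trans ?_ (Finset.single_le_sum hnn hmem)
          rw [Finset.prod_congr rfl fun w hw => if_pos (Finset.mem_filter.1 (hU hw)).2]
          simp
        · exact Finset.sum_nonneg hnn
    _ = ∑ U ∈ K.powersetCard T, prodExp f (fun C =>
          ∏ w ∈ U, if C w ∈ A C then (1 : ℝ) else 0) := prodExp_sum _ _ _
    _ ≤ ∑ U ∈ K.powersetCard T, r ^ T := by
        refine Finset.sum_le_sum fun U hU => ?_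
        obtain ⟨hUK, hUT⟩ := Finset.mem_powersetCard.1 hU
        exact hUT ▸ prodExp_prod_indicator_le hf hf1 K A hA hr hAr U hUK
    _ ≤ (K.card * r) ^ T := by
        rw [Finset.sum_const, Finset.card_powersetCard, nsmul_eq_mul, mul_pow]
        refine mul_le_mul_of_nonneg_right ?_ (pow_nonneg hr T)
        exact_mod_cast Nat.choose_le_pow _ _

/-- Chernoff bound for sums of independent variables with values in `[0, V]`. -/
theorem prodExp_sum_tail_le {f : ι → X → ℝ} (hf : ∀ w x, 0 ≤ f w x)
    (hf1 : ∀ w, ∑ x, f w x = 1) (W : Finset ι) (Y : X → ℝ) {V m t : ℝ} (hV : 0 < V)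
    (hY0 : ∀ x, 0 ≤ Y x) (hYV : ∀ x, Y x ≤ V)
    (hm : ∀ w ∈ W, ∑ x, f w x * Y x ≤ m) :
    prodExp f (fun C => if t < ∑ w ∈ W, Y (C w) then 1 else 0) ≤
      Real.exp (-(t - 2 * (W.card * m)) / V) := by
  have hexp : ∀ y : ℝ, 0 ≤ y → y ≤ 1 → Real.exp y ≤ 1 + 2 * y := by
    intro y hy0 hy1
    have h := Real.abs_exp_sub_one_sub_id_le (abs_le.2 ⟨by linarith, hy1⟩)
    have h' := (abs_le.1 h).2
    nlinarith
  let g : ι → X → ℝ := fun w x => if w ∈ W then Real.exp (Y x / V) else 1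
  have hg : ∀ C : ι → X, ∏ w, g w (C w) = Real.exp ((∑ w ∈ W, Y (C w)) / V) := by
    intro C
    rw [Finset.sum_div, Real.exp_sum]
    simp only [g]
    rw [Finset.prod_ite_mem, Finset.univ_inter]
  calc prodExp f (fun C => if t < ∑ w ∈ W, Y (C w) then 1 else 0)
      ≤ prodExp f (fun C => Real.exp (-t / V) * ∏ w, g w (C w)) := by
        refine prodExp_mono hf fun C => ?_
        rw [hg, ← Real.exp_add]
        split_ifs with h
        · rw [Real.one_le_exp_iff, ← add_div]
          exact div_nonneg (by linarith) hV.le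
        · exact (Real.exp_pos _).le
    _ = Real.exp (-t / V) * ∏ w, ∑ x, f w x * g w x := by
        rw [prodExp_const_mul, prodExp_prod]
    _ ≤ Real.exp (-t / V) * ∏ w, (if w ∈ W then Real.exp (2 * m / V) else 1) := by
        refine mul_le_mul_of_nonneg_left (Finset.prod_le_prod (fun w _ => ?_) fun w _ => ?_)
          (Real.exp_pos _).le
        · refine Finset.sum_nonneg fun x _ => mul_nonneg (hf w x) ?_
          simp only [g]
          split_ifs
          · exact (Real.exp_pos _).le
          · exact zero_le_one
        · simp only [g]
          split_ifs with hw
          · calc ∑ x, f w x * Real.exp (Y x / V)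
                ≤ ∑ x, (f w x + 2 / V * (f w x * Y x)) := by
                  refine Finset.sum_le_sum fun x _ => ?_
                  have h1 := hexp (Y x / V) (div_nonneg (hY0 x) hV.le)
                    ((div_le_one hV).2 (hYV x))
                  calc f w x * Real.exp (Y x / V) ≤ f w x * (1 + 2 * (Y x / V)) :=
                        mul_le_mul_of_nonneg_left h1 (hf w x)
                    _ = _ := by ring
              _ = 1 + 2 / V * ∑ x, f w x * Y x := by
                  rw [Finset.sum_add_distrib, hf1, Finset.mul_sum]
              _ ≤ 1 + 2 / V * m := by
                  have := mul_le_mul_of_nonneg_left (hm w hw) (div_nonneg zero_le_two hV.le)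
                  linarith
              _ = 2 * m / V + 1 := by ring
              _ ≤ Real.exp (2 * m / V) := Real.add_one_le_exp _
          · simp [hf1]
    _ = Real.exp (-(t - 2 * (W.card * m)) / V) := by
        rw [Finset.prod_ite_mem, Finset.univ_inter, Finset.prod_const, ← Real.exp_nat_mul,
          ← Real.exp_add]
        congr 1
        ring

end ProductExpectation

section Hamming

theorem binH_eq_binEntropy_div (t : ℝ) : binH t = Real.binEntropy t / Real.log 2 := by
  rw [Real.binEntropy_eq_negMulLog_add_negMulLog_one_sub, binH, Real.negMulLog, Real.negMulLog,
    Real.logb, Real.logb]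
  ring

theorem continuous_binH : Continuous binH := by
  rw [funext binH_eq_binEntropy_div]
  exact Real.binEntropy_continuous.div_const _

theorem binH_lt_binH {p q : ℝ} (hp : 0 ≤ p) (hpq : p < q) (hq : q ≤ 1 / 2) :
    binH p < binH q := by
  rw [binH_eq_binEntropy_div, binH_eq_binEntropy_div]
  refine div_lt_div_of_pos_right ?_ (Real.log_pos one_lt_two)
  exact Real.binEntropy_strictMonoOn ⟨hp, by norm_num at hq ⊢; linarith⟩
    ⟨by linarith, by norm_num at hq ⊢; linarith⟩ hpq

theorem two_rpow_mul_binH {t : ℝ} (ht0 : 0 < t) (ht1 : t < 1) (n : ℝ) :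
    (2 : ℝ) ^ (n * binH t) = (t ^ (n * t) * (1 - t) ^ (n * (1 - t)))⁻¹ := by
  have h1 : 0 < 1 - t := by linarith
  have h2 := Real.log_pos one_lt_two
  rw [Real.rpow_def_of_pos two_pos, Real.rpow_def_of_pos ht0, Real.rpow_def_of_pos h1,
    ← Real.exp_add, ← Real.exp_neg, binH, Real.logb, Real.logb]
  congr 1
  field_simp
  ring

variable {n : ℕ}

theorem card_hammingBall_le {ρ : ℝ} (h0 : 0 < ρ) (h1 : ρ ≤ 1 / 2) (y : Fin n → Bool) :
    ((Finset.univ.filter fun x : Fin n → Bool => (hammingDist x y : ℝ) ≤ ρ * n).card : ℝ) ≤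
      2 ^ ((n : ℝ) * binH ρ) := by
  have hρ1 : 0 < 1 - ρ := by linarith
  have hsum : ∑ x : Fin n → Bool, ∏ i, (if x i ≠ y i then ρ else 1 - ρ) = 1 := by
    have := Finset.prod_univ_sum (fun _ : Fin n => (Finset.univ : Finset Bool))
      (fun i b => if b ≠ y i then ρ else 1 - ρ)
    rw [Fintype.piFinset_univ] at this
    rw [← this]
    refine Finset.prod_eq_one fun i _ => ?_
    cases y i <;> simp
  have hterm : ∀ x : Fin n → Bool, (hammingDist x y : ℝ) ≤ ρ * n →
      ρ ^ (n * ρ) * (1 - ρ) ^ (n * (1 - ρ)) ≤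
        ∏ i, (if x i ≠ y i then ρ else 1 - ρ) := by
    intro x hx
    rw [Finset.prod_ite, Finset.prod_const, Finset.prod_const]
    have hcard : (Finset.univ.filter fun i => x i ≠ y i).card +
        (Finset.univ.filter fun i => ¬ x i ≠ y i).card = n := by
      simpa using Finset.card_filter_add_card_filter_not (s := Finset.univ) fun i => x i ≠ y i
    have hd : (Finset.univ.filter fun i => x i ≠ y i).card = hammingDist x y := rfl
    rw [hd] at hcard ⊢
    set k := (Finset.univ.filter fun i => ¬ x i ≠ y i).card
    have hcard' : (hammingDist x y : ℝ) + k = n := by exact_mod_cast hcard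
    rw [← Real.rpow_natCast, ← Real.rpow_natCast]
    simp only [Real.rpow_def_of_pos h0, Real.rpow_def_of_pos hρ1, ← Real.exp_add,
      Real.exp_le_exp]
    have hlog : Real.log ρ ≤ Real.log (1 - ρ) := Real.log_le_log h0 (by linarith)
    have hk : (k : ℝ) = n - hammingDist x y := by linarith
    rw [hk]
    nlinarith
  have hpos : 0 < ρ ^ (n * ρ) * (1 - ρ) ^ (n * (1 - ρ)) := by positivity
  rw [two_rpow_mul_binH h0 (by linarith), ← one_div, le_div_iff₀ hpos, ← nsmul_eq_mul,
    ← Finset.sum_const]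
  refine le_of_le_of_eq ?_ hsum
  refine le_trans (Finset.sum_le_sum fun x hx => hterm x (Finset.mem_filter.1 hx).2)
    (Finset.sum_le_sum_of_subset_of_nonneg (Finset.filter_subset _ _) fun x _ _ => ?_)
  refine Finset.prod_nonneg fun i _ => ?_
  split_ifs <;> linarith

theorem card_hammingShell (z : Fin n → Bool) (d : ℕ) :
    (Finset.univ.filter fun x : Fin n → Bool => hammingDist x z = d).card = n.choose d := by
  have : n.choose d = ((Finset.univ : Finset (Fin n)).powersetCard d).card := by simp
  rw [this]
  refine Finset.card_nbij' (fun x => Finset.univ.filter fun i => x i ≠ z i)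
    (fun S i => if i ∈ S then !z i else z i) ?_ ?_ ?_ ?_
  · intro x hx
    simp only [Finset.coe_filter, Finset.mem_univ, true_and, Set.mem_ofPred_eq] at hx
    exact Finset.mem_powersetCard.2 ⟨Finset.subset_univ _, hx⟩
  · intro S hS
    simp only [Finset.mem_coe, Finset.mem_powersetCard] at hS
    simp only [Finset.coe_filter, Finset.mem_univ, true_and, Set.mem_ofPred_eq]
    rw [← hS.2, hammingDist]
    congr 1
    ext i
    by_cases hi : i ∈ S <;> simp [hi]
  · intro x _
    funext i
    by_cases hi : x i = z i
    · simp [hi]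
    · simp [Bool.eq_not_of_ne hi]
  · intro S _
    ext i
    by_cases hi : i ∈ S <;> simp [hi]

theorem two_mul_choose_le_two_pow (hn : n ≠ 0) (d : ℕ) : 2 * n.choose d ≤ 2 ^ n := by
  obtain ⟨m, rfl⟩ := Nat.exists_eq_succ_of_ne_zero hn
  have hle : (m + 1).choose d ≤ 2 ^ m := by
    cases d with
    | zero => simpa using Nat.one_le_two_pow
    | succ d =>
      rw [Nat.choose_succ_succ]
      by_cases hd : d + 1 ≤ m
      · rw [← Nat.sum_range_choose m, ← Finset.sum_pair (Nat.succ_ne_self d).symm]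
        refine Finset.sum_le_sum_of_subset fun k hk => ?_
        simp only [Finset.mem_insert, Finset.mem_singleton] at hk
        rw [Finset.mem_range]
        omega
      · rw [Nat.choose_eq_zero_of_lt (not_le.1 hd), add_zero]
        exact Nat.choose_le_two_pow _ _
  rw [pow_succ, mul_comm]
  exact Nat.mul_le_mul_right _ hle

theorem factorial_mul_pow_le (d k : ℕ) : d.factorial * d ^ k ≤ k.factorial * d ^ d := by
  rcases le_total d k with h | h
  · calc d.factorial * d ^ k = d.factorial * d ^ (k - d) * d ^ d := by
          rw [mul_assoc, ← pow_add, Nat.sub_add_cancel h]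
      _ ≤ _ := Nat.mul_le_mul_right _ (Nat.factorial_mul_pow_sub_le_factorial h)
  · have hd : d.factorial ≤ k.factorial * d ^ (d - k) := by
      have := Nat.factorial_mul_descFactorial (Nat.sub_le d k)
      rw [Nat.sub_sub_self h] at this
      rw [← this]
      exact Nat.mul_le_mul_left _ (Nat.descFactorial_le_pow _ _)
    calc d.factorial * d ^ k ≤ k.factorial * d ^ (d - k) * d ^ k := Nat.mul_le_mul_right _ hd
      _ = _ := by rw [mul_assoc, ← pow_add, Nat.sub_add_cancel h]

theorem pow_self_le_choose_mul {d : ℕ} (hd : d ≤ n) :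
    n ^ n ≤ (n + 1) * (n.choose d * (d ^ d * (n - d) ^ (n - d))) := by
  have hmode : ∀ k ≤ n, d ^ k * (n - d) ^ (n - k) * n.choose k ≤
      n.choose d * (d ^ d * (n - d) ^ (n - d)) := by
    intro k hk
    have h1 := Nat.mul_le_mul (factorial_mul_pow_le d k) (factorial_mul_pow_le (n - d) (n - k))
    have hk' := Nat.choose_mul_factorial_mul_factorial hk
    have hd' := Nat.choose_mul_factorial_mul_factorial hd
    refine Nat.le_of_mul_le_mul_left ?_ (Nat.mul_pos (Nat.mul_pos d.factorial_pos
      (n - d).factorial_pos) (Nat.mul_pos k.factorial_pos (n - k).factorial_pos))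
    calc _ = (d.factorial * d ^ k * ((n - d).factorial * (n - d) ^ (n - k))) *
          (n.choose k * k.factorial * (n - k).factorial) := by ring
      _ ≤ (k.factorial * d ^ d * ((n - k).factorial * (n - d) ^ (n - d))) *
          (n.choose k * k.factorial * (n - k).factorial) := Nat.mul_le_mul_right _ h1
      _ = (k.factorial * d ^ d * ((n - k).factorial * (n - d) ^ (n - d))) *
          (n.choose d * d.factorial * (n - d).factorial) := by rw [hk', hd']
      _ = _ := by ring
  calc n ^ n = (d + (n - d)) ^ n := by rw [Nat.add_sub_cancel' hd]
    _ = ∑ k ∈ Finset.range (n + 1), d ^ k * (n - d) ^ (n - k) * n.choose k := by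
        rw [add_pow]
        simp
    _ ≤ ∑ k ∈ Finset.range (n + 1), n.choose d * (d ^ d * (n - d) ^ (n - d)) :=
        Finset.sum_le_sum fun k hk => hmode k (Nat.lt_succ_iff.1 (Finset.mem_range.1 hk))
    _ = _ := by simp

theorem two_rpow_binH_le_choose {d : ℕ} (hd0 : 0 < d) (hdn : d < n) :
    (2 : ℝ) ^ ((n : ℝ) * binH ((d : ℝ) / n)) ≤ (n + 1) * n.choose d := by
  have hn : (0 : ℝ) < n := by exact_mod_cast hd0.trans hdn
  have hd : (0 : ℝ) < d := by exact_mod_cast hd0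
  have hdn' : (d : ℝ) < n := by exact_mod_cast hdn
  rw [two_rpow_mul_binH (div_pos hd hn) ((div_lt_one hn).2 hdn')]
  have e1 : (n : ℝ) * (d / n) = (d : ℕ) := by field_simp
  have e2 : (n : ℝ) * (1 - d / n) = ((n - d : ℕ) : ℝ) := by
    rw [Nat.cast_sub hdn.le]; field_simp
  have e3 : 1 - (d : ℝ) / n = ((n - d : ℕ) : ℝ) / n := by
    rw [Nat.cast_sub hdn.le]; field_simp
  have hnd : (0 : ℝ) < ((n - d : ℕ) : ℝ) := by exact_mod_cast Nat.sub_pos_of_lt hdn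
  rw [e1, e2, e3, Real.rpow_natCast, Real.rpow_natCast, div_pow, div_pow, div_mul_div_comm,
    ← pow_add, Nat.add_sub_cancel' hdn.le, inv_div, div_le_iff₀ (by positivity)]
  have := pow_self_le_choose_mul hdn.le
  rw [mul_assoc]
  exact_mod_cast this

end Hamming

section Blocks

variable {N : ℕ}

theorem rankIn_injOn (M : Finset (Fin N)) : Set.InjOn (rankIn M) M := by
  have hlt : ∀ u ∈ M, ∀ v, u < v → rankIn M u < rankIn M v := by
    intro u hu v huv
    refine Finset.card_lt_card ⟨fun w hw => ?_, fun h => ?_⟩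
    · rw [Finset.mem_filter] at hw ⊢
      exact ⟨hw.1, hw.2.trans huv⟩
    · exact lt_irrefl u (Finset.mem_filter.1 (h (Finset.mem_filter.2 ⟨hu, huv⟩))).2
  intro u hu v hv huv
  rcases lt_trichotomy u v with h | h | h
  · exact absurd huv (hlt u hu v h).ne
  · exact h
  · exact absurd huv (hlt v hv u h).ne'

theorem blockOf_subset (M : Finset (Fin N)) (B k : ℕ) : blockOf M B k ⊆ M :=
  Finset.filter_subset _ _

theorem card_blockOf_le (M : Finset (Fin N)) {B : ℕ} (hB : 0 < B) (k : ℕ) :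
    (blockOf M B k).card ≤ B := by
  have : (blockOf M B k).card ≤ (Finset.Ico (k * B) (k * B + B)).card := by
    refine Finset.card_le_card_of_injOn (rankIn M) (fun w hw => ?_)
      ((rankIn_injOn M).mono (Finset.coe_subset.2 (blockOf_subset M B k)))
    have hk := (Finset.mem_filter.1 hw).2
    have h := (Nat.div_eq_iff hB).1 hk
    rw [Finset.mem_coe, Finset.mem_Ico]
    omega
  simpa using this

theorem numBlocks_le (M : Finset (Fin N)) {B : ℕ} (hB : 0 < B) : numBlocks M B ≤ N + 1 := by
  have hM : M.card ≤ N := by simpa using Finset.card_le_univ M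
  refine Nat.div_le_of_le_mul ?_
  nlinarith [Nat.sub_le (M.card + B) 1, Nat.add_sub_of_le (show 1 ≤ M.card + B by omega)]

end Blocks

section ShellCode

variable {n N : ℕ}

/-- The mass function of a single codeword under `shellCodeProb`. -/
noncomputable def shellMass (M : Finset (Fin N)) (z : Fin n → Bool) (d : ℕ) (w : Fin N)
    (x : Fin n → Bool) : ℝ :=
  if w ∈ M then (if hammingDist x z = d then (n.choose d : ℝ)⁻¹ else 0)
  else (if hammingDist x z = d then 0 else ((2 : ℝ) ^ n - n.choose d)⁻¹)

theorem natCard_hammingShell (z : Fin n → Bool) (d : ℕ) :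
    Nat.card {x : Fin n → Bool // hammingDist x z = d} = n.choose d := by
  rw [Nat.card_eq_fintype_card, Fintype.card_subtype, card_hammingShell]

theorem shellCodeProb_eq (M : Finset (Fin N)) (z : Fin n → Bool) (d : ℕ)
    (C : Fin N → Fin n → Bool) :
    shellCodeProb n N M z d C = ∏ w, shellMass M z d w (C w) := by
  simp only [shellCodeProb, shellMass, natCard_hammingShell, one_div]

theorem two_pow_div_two_le (hn : n ≠ 0) (d : ℕ) :
    (2 : ℝ) ^ n / 2 ≤ 2 ^ n - n.choose d := by
  have : (2 : ℝ) * n.choose d ≤ 2 ^ n := by exact_mod_cast two_mul_choose_le_two_pow hn d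
  linarith

theorem two_pow_sub_choose_pos (hn : n ≠ 0) (d : ℕ) : (0 : ℝ) < 2 ^ n - n.choose d :=
  lt_of_lt_of_le (by positivity) (two_pow_div_two_le hn d)

theorem shellMass_nonneg (hn : n ≠ 0) (M : Finset (Fin N)) (z : Fin n → Bool) (d : ℕ)
    (w : Fin N) (x : Fin n → Bool) : 0 ≤ shellMass M z d w x := by
  have h := (two_pow_sub_choose_pos hn d).le
  unfold shellMass
  split_ifs <;> positivity

theorem sum_shellMass (hn : n ≠ 0) {d : ℕ} (hd : d ≤ n) (M : Finset (Fin N))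
    (z : Fin n → Bool) (w : Fin N) : ∑ x, shellMass M z d w x = 1 := by
  have hc : (0 : ℝ) < n.choose d := by exact_mod_cast Nat.choose_pos hd
  by_cases hw : w ∈ M
  · simp only [shellMass, if_pos hw]
    rw [← Finset.sum_filter, Finset.sum_const, card_hammingShell, nsmul_eq_mul,
      mul_inv_cancel₀ hc.ne']
  · simp only [shellMass, if_neg hw]
    have hcard := Finset.card_filter_add_card_filter_not
      (s := (Finset.univ : Finset (Fin n → Bool))) fun x => hammingDist x z = d
    rw [card_hammingShell] at hcard
    have hcard' : (n.choose d : ℝ) + ((Finset.univ.filter fun x : Fin n → Bool =>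
        ¬ hammingDist x z = d).card : ℝ) = 2 ^ n := by
      rw [← Nat.cast_add, hcard]
      simp
    simp only [← ite_not (p := hammingDist _ z = d)]
    rw [← Finset.sum_filter, Finset.sum_const, nsmul_eq_mul, eq_sub_of_add_eq' hcard',
      mul_inv_cancel₀ (two_pow_sub_choose_pos hn d).ne']

theorem xorVec_xorVec (x s : Fin n → Bool) : xorVec (xorVec x s) s = x := by
  funext i
  simp [xorVec]

/-- Indicator that `x` lies on the shell and `x ⊕ s` is `ρ`-close to `y`. -/
noncomputable def confusable (z : Fin n → Bool) (d : ℕ) (s : Fin n → Bool) (ρ : ℝ)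
    (x y : Fin n → Bool) : ℝ :=
  if hammingDist x z = d ∧ (hammingDist (xorVec x s) y : ℝ) ≤ ρ then 1 else 0

theorem confusable_nonneg (z : Fin n → Bool) (d : ℕ) (s : Fin n → Bool) (ρ : ℝ)
    (x y : Fin n → Bool) : 0 ≤ confusable z d s ρ x y := by
  unfold confusable
  split_ifs <;> norm_num

theorem sum_confusable_left_le {z s : Fin n → Bool} {d : ℕ} {ρ V : ℝ}
    (hball : ∀ y : Fin n → Bool,
      ((Finset.univ.filter fun x : Fin n → Bool => (hammingDist x y : ℝ) ≤ ρ).card : ℝ) ≤ V)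
    (y : Fin n → Bool) : ∑ x, confusable z d s ρ x y ≤ V := by
  simp only [confusable]
  rw [← Finset.sum_filter, Finset.sum_const, nsmul_eq_mul, mul_one]
  refine le_trans ?_ (hball y)
  rw [Nat.cast_le]
  refine Finset.card_le_card_of_injOn (fun x => xorVec x s) (fun x hx => ?_) ?_
  · have hx := (Finset.mem_filter.1 hx).2.2
    exact Finset.mem_coe.2 (Finset.mem_filter.2 ⟨Finset.mem_univ _, hx⟩)
  · intro x _ x' _ h
    rw [← xorVec_xorVec x s, ← xorVec_xorVec x' s]
    exact congrArg (fun v => xorVec v s) h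

theorem sum_sum_confusable_le {z s : Fin n → Bool} {d : ℕ} {ρ V : ℝ}
    (hball : ∀ y : Fin n → Bool,
      ((Finset.univ.filter fun x : Fin n → Bool => (hammingDist x y : ℝ) ≤ ρ).card : ℝ) ≤ V) :
    ∑ y, ∑ x, confusable z d s ρ x y ≤ n.choose d * V := by
  rw [Finset.sum_comm]
  calc ∑ x, ∑ y, confusable z d s ρ x y
      ≤ ∑ x : Fin n → Bool, if hammingDist x z = d then V else 0 := by
        refine Finset.sum_le_sum fun x _ => ?_
        split_ifs with hx
        · simp only [confusable, hx, true_and]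
          rw [← Finset.sum_filter, Finset.sum_const, nsmul_eq_mul, mul_one]
          simpa only [hammingDist_comm] using hball (xorVec x s)
        · simp [confusable, hx]
    _ = n.choose d * V := by
        rw [← Finset.sum_filter, Finset.sum_const, card_hammingShell, nsmul_eq_mul]

/-- Non-asymptotic form of the list-decoding bound, in terms of a bound `V` on the volume of
Hamming balls and a threshold `t` for the total number of confusable shell points. -/
theorem shellCode_tail_bound (hn : n ≠ 0) {d : ℕ} (hd : d ≤ n) (z s : Fin n → Bool)
    (M : Finset (Fin N)) {B : ℕ} (hB : 0 < B) {ρ V t r thr : ℝ} (hV : 0 < V)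
    (hball : ∀ y : Fin n → Bool,
      ((Finset.univ.filter fun x : Fin n → Bool => (hammingDist x y : ℝ) ≤ ρ).card : ℝ) ≤ V)
    (hr : 0 ≤ r) (htr : M.card * V + t ≤ n.choose d * r) {T : ℕ} (hT : (T : ℝ) ≤ thr) :
    1 - (Real.exp (-(t - 2 * (N * (2 * n.choose d * V / 2 ^ n))) / V) +
        numBlocks M B * (B * r) ^ T) ≤
      ∑ C : Fin N → Fin n → Bool, shellCodeProb n N M z d C *
        (if ∀ k : ℕ, k + 1 < numBlocks M B →
            (Nat.card {w : Fin N // w ∈ blockOf M B k ∧ ∃ w' : Fin N,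
                w' ∉ blockOf M B k ∧
                (hammingDist (xorVec (C w) s) (C w') : ℝ) ≤ ρ} : ℝ) ≤ thr
          then (1 : ℝ) else 0) := by
  let E : (Fin N → Fin n → Bool) → Prop := fun C => ∀ k : ℕ, k + 1 < numBlocks M B →
    (Nat.card {w : Fin N // w ∈ blockOf M B k ∧ ∃ w' : Fin N, w' ∉ blockOf M B k ∧
      (hammingDist (xorVec (C w) s) (C w') : ℝ) ≤ ρ} : ℝ) ≤ thr
  change _ ≤ ∑ C, shellCodeProb n N M z d C * if E C then 1 else 0
  set f := shellMass M z d with hf_def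
  have hf : ∀ w x, 0 ≤ f w x := shellMass_nonneg hn M z d
  have hf1 : ∀ w, ∑ x, f w x = 1 := sum_shellMass hn hd M z
  have hc : (0 : ℝ) < n.choose d := by exact_mod_cast Nat.choose_pos hd
  let Y : (Fin n → Bool) → ℝ := fun y => ∑ x, confusable z d s ρ x y
  have hY0 : ∀ y, 0 ≤ Y y := fun y =>
    Finset.sum_nonneg fun x _ => confusable_nonneg z d s ρ x y
  have hYV : ∀ y, Y y ≤ V := sum_confusable_left_le hball
  let S : (Fin N → Fin n → Bool) → ℝ := fun C => ∑ w ∈ Mᶜ, Y (C w)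
  obtain ⟨A, hAmem⟩ : ∃ A : ℕ → (Fin N → Fin n → Bool) → Set (Fin n → Bool), ∀ k C x,
      x ∈ A k C ↔ ¬ t < S C ∧
        ∃ w' ∉ blockOf M B k, (hammingDist (xorVec x s) (C w') : ℝ) ≤ ρ :=
    ⟨fun k C => {x | ¬ t < S C ∧
      ∃ w' ∉ blockOf M B k, (hammingDist (xorVec x s) (C w') : ℝ) ≤ ρ}, fun _ _ _ => Iff.rfl⟩
  have hA : ∀ k, ∀ C C' : Fin N → Fin n → Bool, (∀ w ∉ blockOf M B k, C w = C' w) →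
      A k C = A k C' := by
    intro k C C' h
    have hS : S C = S C' := Finset.sum_congr rfl fun w hw => by
      rw [h w fun hwk => Finset.mem_compl.1 hw (blockOf_subset M B k hwk)]
    ext x
    simp only [hAmem, hS]
    refine and_congr_right fun _ => exists_congr fun w' => and_congr_right fun hw' => ?_
    rw [h w' hw']
  have hAr : ∀ k C, ∀ w ∈ blockOf M B k, ∑ x, f w x * (if x ∈ A k C then 1 else 0) ≤ r := by
    intro k C w hw
    by_cases hS : t < S C
    · simpa [hAmem, hS] using hr
    calc ∑ x, f w x * (if x ∈ A k C then 1 else 0)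
        ≤ ∑ x, ∑ w', (n.choose d : ℝ)⁻¹ * confusable z d s ρ x (C w') := by
          refine Finset.sum_le_sum fun x _ => ?_
          have hnn : ∀ w' ∈ Finset.univ, 0 ≤ (n.choose d : ℝ)⁻¹ * confusable z d s ρ x (C w') :=
            fun w' _ => mul_nonneg (inv_nonneg.2 hc.le) (confusable_nonneg _ _ _ _ _ _)
          by_cases hxA : x ∈ A k C
          · obtain ⟨-, w', -, hw'⟩ := (hAmem k C x).1 hxA
            refine le_trans ?_ (Finset.single_le_sum hnn (Finset.mem_univ w'))
            by_cases hx : hammingDist x z = d <;>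
              simp [hf_def, shellMass, blockOf_subset M B k hw, confusable, hx, hw', hxA]
          · rw [if_neg hxA, mul_zero]
            exact Finset.sum_nonneg hnn
      _ = (n.choose d : ℝ)⁻¹ * ∑ w', Y (C w') := by
          rw [Finset.sum_comm]
          simp only [Y, Finset.mul_sum]
      _ ≤ (n.choose d : ℝ)⁻¹ * (n.choose d * r) := by
          refine mul_le_mul_of_nonneg_left ?_ (inv_nonneg.2 hc.le)
          rw [← Finset.sum_add_sum_compl M]
          refine le_trans (add_le_add ?_ (not_lt.1 hS)) htr
          rw [← nsmul_eq_mul]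
          exact Finset.sum_le_card_nsmul _ _ _ fun w' _ => hYV _
      _ = r := inv_mul_cancel_left₀ hc.ne' r
  have hm : ∀ w ∈ Mᶜ, ∑ y, f w y * Y y ≤ 2 * n.choose d * V / 2 ^ n := by
    intro w hw
    calc ∑ y, f w y * Y y ≤ ∑ y, (2 : ℝ) / 2 ^ n * Y y := by
          refine Finset.sum_le_sum fun y _ => mul_le_mul_of_nonneg_right ?_ (hY0 y)
          simp only [hf_def, shellMass, if_neg (Finset.mem_compl.1 hw)]
          split_ifs
          · positivity
          · rw [← inv_div]
            exact inv_anti₀ (by positivity) (two_pow_div_two_le hn d)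
      _ = 2 / 2 ^ n * ∑ y, Y y := (Finset.mul_sum _ _ _).symm
      _ ≤ 2 / 2 ^ n * (n.choose d * V) :=
          mul_le_mul_of_nonneg_left (sum_sum_confusable_le hball) (by positivity)
      _ = _ := by ring
  have hgood : prodExp f (fun C => if t < S C then 1 else 0) ≤
      Real.exp (-(t - 2 * (N * (2 * n.choose d * V / 2 ^ n))) / V) := by
    refine (prodExp_sum_tail_le hf hf1 Mᶜ Y hV hY0 hYV hm).trans (Real.exp_le_exp.2 ?_)
    have hN : ((Mᶜ).card : ℝ) ≤ N := by
      exact_mod_cast (Finset.card_le_univ Mᶜ).trans_eq (Fintype.card_fin N)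
    have := mul_le_mul_of_nonneg_right hN
      (show (0 : ℝ) ≤ 2 * n.choose d * V / 2 ^ n by positivity)
    refine div_le_div_of_nonneg_right ?_ hV.le
    linarith
  have hblock : ∀ k, prodExp f (fun C =>
      if T ≤ ((blockOf M B k).filter fun w => C w ∈ A k C).card then 1 else 0) ≤
        (B * r) ^ T := by
    intro k
    refine (prodExp_card_tail_le hf hf1 _ (A k) (hA k) hr (hAr k) T).trans ?_
    have := card_blockOf_le M hB k
    gcongr
  have hsplit : prodExp f (fun _ => 1) ≤ prodExp f (fun C =>
      ((if t < S C then 1 else 0) + ∑ k ∈ Finset.range (numBlocks M B),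
        if T ≤ ((blockOf M B k).filter fun w => C w ∈ A k C).card then (1 : ℝ) else 0) +
      if E C then (1 : ℝ) else 0) := by
    refine prodExp_mono hf fun C => ?_
    have hnn : ∀ k ∈ Finset.range (numBlocks M B), (0 : ℝ) ≤
        if T ≤ ((blockOf M B k).filter fun w => C w ∈ A k C).card then (1 : ℝ) else 0 :=
      fun k _ => by split_ifs <;> norm_num
    have hsum := Finset.sum_nonneg hnn
    by_cases hS : t < S C
    · rw [if_pos hS]
      split_ifs <;> linarith
    · by_cases hev : E C
      · rw [if_neg hS, if_pos hev]
        linarith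
      · rw [if_neg hS, if_neg hev, zero_add, add_zero]
        simp only [E] at hev
        push Not at hev
        obtain ⟨k, hk, hcard⟩ := hev
        refine le_trans ?_ (Finset.single_le_sum hnn (Finset.mem_range.2 (Nat.lt_of_succ_lt hk)))
        have hle : T ≤ ((blockOf M B k).filter fun w => C w ∈ A k C).card := by
          rw [Nat.card_eq_fintype_card, Fintype.card_subtype] at hcard
          have h := (Nat.cast_lt (α := ℝ)).1 (hT.trans_lt hcard)
          refine h.le.trans (Finset.card_le_card fun w hw => ?_)
          obtain ⟨hw1, hw2⟩ := (Finset.mem_filter.1 hw).2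
          exact Finset.mem_filter.2 ⟨hw1, (hAmem k C _).2 ⟨hS, hw2⟩⟩
        rw [if_pos hle]
  rw [prodExp_one hf1, prodExp_add, prodExp_add, prodExp_sum] at hsplit
  have hblocks := Finset.sum_le_sum fun k (_ : k ∈ Finset.range (numBlocks M B)) => hblock k
  rw [Finset.sum_const, Finset.card_range, nsmul_eq_mul] at hblocks
  have hlast : prodExp f (fun C => if E C then 1 else 0) =
      ∑ C, shellCodeProb n N M z d C * if E C then 1 else 0 := by
    simp only [shellCodeProb_eq]
    exact Finset.sum_congr (by ext; simp) fun C _ => rfl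
  linarith

end ShellCode

section Asymptotics

theorem eventually_cubic_le_two_rpow {η : ℝ} (h0 : 0 < η) (h1 : η ≤ 1) :
    ∃ n₀ : ℕ, ∀ n : ℕ, n₀ ≤ n → n ≠ 0 ∧ 10 ≤ η * n ∧ 32 ≤ ((2 : ℝ) ^ (η * n)) ^ 2 ∧
      ((n : ℝ) + 1) * (η * (n : ℝ) ^ 2 + 4) ≤ ((2 : ℝ) ^ (η * n)) ^ 2 := by
  have hr : (1 : ℝ) < 2 ^ (2 * η) := Real.one_lt_rpow one_lt_two (by positivity)
  have hev := (tendsto_pow_const_div_const_pow_of_one_lt 3 hr).eventually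
    (gt_mem_nhds (show (0 : ℝ) < 1 / 10 by norm_num))
  obtain ⟨n₁, hn₁⟩ := Filter.eventually_atTop.1 hev
  obtain ⟨n₂, hn₂⟩ := exists_nat_ge (10 / η)
  refine ⟨max n₁ (max n₂ 2), fun n hn => ?_⟩
  have hle1 : n₁ ≤ n := (le_max_left _ _).trans hn
  have hle2 : n₂ ≤ n := ((le_max_left _ _).trans (le_max_right _ _)).trans hn
  have hle3 : 2 ≤ n := ((le_max_right _ _).trans (le_max_right _ _)).trans hn
  have hn2 : (2 : ℝ) ≤ n := by exact_mod_cast hle3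
  have hsq : ((2 : ℝ) ^ (η * n)) ^ 2 = ((2 : ℝ) ^ (2 * η)) ^ n := by
    rw [← Real.rpow_natCast, ← Real.rpow_natCast, ← Real.rpow_mul two_pos.le,
      ← Real.rpow_mul two_pos.le]
    congr 1
    push_cast
    ring
  have hcube : 10 * (n : ℝ) ^ 3 ≤ ((2 : ℝ) ^ (η * n)) ^ 2 := by
    have h := hn₁ n hle1
    rw [div_lt_iff₀ (by positivity)] at h
    rw [hsq]
    linarith
  have hn3 : (8 : ℝ) ≤ (n : ℝ) ^ 3 := by
    have := pow_le_pow_left₀ two_pos.le hn2 3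
    linarith
  refine ⟨by omega, ?_, by linarith, le_trans ?_ hcube⟩
  · have := (div_le_iff₀ h0).1 (hn₂.trans (Nat.cast_le.2 hle2))
    linarith
  · have hA : (n : ℝ) + 1 ≤ 2 * n := by linarith
    have hB : η * (n : ℝ) ^ 2 + 4 ≤ 5 * (n : ℝ) ^ 2 := by nlinarith [sq_nonneg (n : ℝ)]
    calc ((n : ℝ) + 1) * (η * (n : ℝ) ^ 2 + 4) ≤ 2 * n * (5 * (n : ℝ) ^ 2) :=
          mul_le_mul hA hB (by positivity) (by positivity)
      _ = 10 * (n : ℝ) ^ 3 := by ring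

theorem chernoff_exponent_le {η n x V Sh μ : ℝ} (hn : 0 < n) (hx : 0 < x) (hV : 0 < V)
    (h32 : 32 ≤ x ^ 2) (hcub : (n + 1) * (η * n ^ 2 + 4) ≤ x ^ 2)
    (hVSh : V * x ^ 4 ≤ (n + 1) * Sh) (hSh : 0 < Sh) (hμ : μ * x ^ 4 ≤ 4 * Sh) :
    Real.exp (-(Sh * (x ^ 2)⁻¹ / 2 - 2 * μ) / V) ≤ Real.exp (-(η / 4) * n ^ 2) / 2 := by
  have hx2 : 0 < x ^ 2 := by positivity
  have hexp : (η / 4 * n ^ 2 + 1) * V ≤ Sh * (x ^ 2)⁻¹ / 2 - 2 * μ := by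
    have h1 : 2 * μ ≤ Sh * (x ^ 2)⁻¹ / 4 := by
      rw [← div_eq_mul_inv, div_div, le_div_iff₀ (by positivity)]
      refine le_of_mul_le_mul_right ?_ hx2
      nlinarith
    have h2 : (η / 4 * n ^ 2 + 1) * V ≤ Sh * (x ^ 2)⁻¹ / 4 := by
      rw [← div_eq_mul_inv, div_div, le_div_iff₀ (by positivity)]
      refine le_of_mul_le_mul_right (a := (n + 1) * x ^ 2) ?_ (by positivity)
      calc (η / 4 * n ^ 2 + 1) * V * (x ^ 2 * 4) * ((n + 1) * x ^ 2)
          = (n + 1) * (η * n ^ 2 + 4) * (V * x ^ 4) := by ring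
        _ ≤ x ^ 2 * ((n + 1) * Sh) := mul_le_mul hcub hVSh (by positivity) hx2.le
        _ = Sh * ((n + 1) * x ^ 2) := by ring
    linarith
  have hle : -(Sh * (x ^ 2)⁻¹ / 2 - 2 * μ) / V ≤ -(η / 4) * n ^ 2 + -1 := by
    rw [div_le_iff₀ hV]
    linarith
  refine (Real.exp_le_exp.2 hle).trans ?_
  rw [Real.exp_add, Real.exp_neg 1, div_eq_mul_inv]
  have : (2 : ℝ) ≤ Real.exp 1 := by linarith [Real.add_one_le_exp (1 : ℝ)]
  exact mul_le_mul_of_nonneg_left (inv_anti₀ two_pos this) (Real.exp_pos _).le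

theorem union_bound_exponent_le {η : ℝ} {n : ℕ} (hn : n ≠ 0) (h10 : 10 ≤ η * n) :
    4 * (2 : ℝ) ^ n * (2 / 2 ^ (η * n)) ^ n ≤ Real.exp (-(η / 4) * (n : ℝ) ^ 2) / 2 := by
  have hl2 : 1 / 2 ≤ Real.log 2 := by linarith [Real.log_two_gt_d9]
  have hn1 : (1 : ℝ) ≤ n := by exact_mod_cast Nat.one_le_iff_ne_zero.2 hn
  rw [le_div_iff₀ two_pos]
  have heq : 4 * (2 : ℝ) ^ n * (2 / 2 ^ (η * n)) ^ n * 2 =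
      Real.exp (Real.log 2 * (3 + 2 * n - η * n * n)) := by
    have h8 : (2 : ℝ) ^ (3 : ℝ) = 8 := by norm_num
    rw [← Real.rpow_def_of_pos two_pos, Real.rpow_sub two_pos, Real.rpow_add two_pos,
      Real.rpow_mul two_pos.le (η * n), two_mul (n : ℝ), Real.rpow_add two_pos, h8,
      Real.rpow_natCast, Real.rpow_natCast, div_pow]
    ring
  rw [heq, Real.exp_le_exp]
  have h5 : 3 + 2 * (n : ℝ) ≤ η * n * n / 2 := by nlinarith
  nlinarith

end Asymptotics

/-- **List-decoding outside the oracle-given set (Lemma 6 of the paper).** For all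
sufficiently small `ε₁, ε₂, δ > 0` there are `β > 0` and a constant `c` such that for all
large `n`, for every `z`, every `d` with `|d - qn| ≤ ε₁n`, every state vector `s` of weight
at most `pn` and every admissible set `M` of messages on the shell `Sh(z,d)`, with
probability at least `1 - e^{-βn²}` over the conditional code distribution, every
non-final block `M^{(i)}` of the ordered partition of `M` contains at most `c²n⁴`
messages `w` for which some message `w' ∉ M^{(i)}` satisfies
`d_H(X(w) ⊕ s, X(w')) ≤ (p+ε₁)n`. -/
theorem list_decoding_outside_block (p q R : ℝ) (hp0 : 0 < p) (hpq : p < q)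
    (hq : q ≤ 1 / 2) (hR1 : 1 - binH q < R) (hR2 : R < 1 - binH p) :
    ∃ ε₀ > (0 : ℝ), ∀ ε₁ ε₂ δ : ℝ,
      0 < ε₁ → ε₁ ≤ ε₀ → 0 < ε₂ → ε₂ ≤ ε₀ → 0 < δ → δ ≤ ε₀ →
      ∃ β > (0 : ℝ), ∃ c : ℝ, ∃ n₀ : ℕ, ∀ n : ℕ, n₀ ≤ n →
      ∀ N : ℕ, N = ⌈(2 : ℝ) ^ (R * n)⌉₊ →
      ∀ B : ℕ, B = ⌈(2 : ℝ) ^ ((n : ℝ) * δ)⌉₊ →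
      ∀ (z : Fin n → Bool) (d : ℕ), |(d : ℝ) - q * n| ≤ ε₁ * n →
      ∀ s : Fin n → Bool, (wt s : ℝ) ≤ p * n →
      ∀ M : Finset (Fin N),
        (2 : ℝ) ^ ((n : ℝ) * (binH ((d : ℝ) / n) + R - 1 - ε₂)) ≤ (M.card : ℝ) →
        (M.card : ℝ) ≤ (2 : ℝ) ^ ((n : ℝ) * (binH ((d : ℝ) / n) + R - 1 + ε₂)) →
        1 - Real.exp (-β * (n : ℝ) ^ 2) ≤
          ∑ C : Fin N → Fin n → Bool, shellCodeProb n N M z d C *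
            (if ∀ k : ℕ, k + 1 < numBlocks M B →
                (Nat.card {w : Fin N // w ∈ blockOf M B k ∧ ∃ w' : Fin N,
                    w' ∉ blockOf M B k ∧
                    (hammingDist (xorVec (C w) s) (C w') : ℝ) ≤ (p + ε₁) * n} : ℝ)
                  ≤ c ^ 2 * (n : ℝ) ^ 4
              then (1 : ℝ) else 0) := by
  obtain ⟨η, hη0, hη1, hg1, hg2⟩ : ∃ η : ℝ, 0 < η ∧ η ≤ 1 ∧ 8 * η ≤ 1 - R - binH p ∧
      8 * η ≤ binH q - binH p := by
    have h1 : 0 < 1 - R - binH p := by linarith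
    have h2 : 0 < binH q - binH p := sub_pos.2 (binH_lt_binH hp0.le hpq hq)
    refine ⟨min 1 (min ((1 - R - binH p) / 8) ((binH q - binH p) / 8)), by positivity,
      min_le_left _ _, ?_, ?_⟩
    · have := (min_le_right 1 _).trans (min_le_left ((1 - R - binH p) / 8)
        ((binH q - binH p) / 8))
      linarith
    · have := (min_le_right 1 _).trans (min_le_right ((1 - R - binH p) / 8)
        ((binH q - binH p) / 8))
      linarith
  have hbinHq : binH q ≤ 1 := by
    rw [binH_eq_binEntropy_div, div_le_one (Real.log_pos one_lt_two)]
    exact Real.binEntropy_le_log_two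
  have hR0 : 0 < R := by linarith
  obtain ⟨rp, hrp0, hrp⟩ := Metric.continuous_iff.1 continuous_binH p η hη0
  obtain ⟨rq, hrq0, hrq⟩ := Metric.continuous_iff.1 continuous_binH q η hη0
  simp only [Real.dist_eq] at hrp hrq
  have hq0 : 0 < q := hp0.trans hpq
  have hp2 : 0 < 1 / 2 - p := by linarith
  refine ⟨min (min (rp / 2) (rq / 2)) (min η (min (q / 2) (1 / 2 - p))), by positivity, ?_⟩
  intro ε₁ ε₂ δ hε₁ hε₁' hε₂ hε₂' hδ hδ'
  simp only [le_min_iff] at hε₁' hε₂' hδ'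
  obtain ⟨n₀, hn₀⟩ := eventually_cubic_le_two_rpow hη0 hη1
  refine ⟨η / 4, by positivity, 1, n₀, ?_⟩
  intro n hn N hN B hB z d hd s hs M hM1 hM2
  obtain ⟨hn0, h10, h32, hcub⟩ := hn₀ n hn
  have hnpos : (0 : ℝ) < n := by exact_mod_cast Nat.pos_of_ne_zero hn0
  have hdq : |(d : ℝ) / n - q| ≤ ε₁ := by
    have : (d : ℝ) / n - q = (d - q * n) / n := by field_simp
    rw [this, abs_div, abs_of_pos hnpos, div_le_iff₀ hnpos]
    exact hd
  obtain ⟨hdl, hdu⟩ := abs_le.1 hdq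
  have hd0 : 0 < d := by
    have : (0 : ℝ) < d / n := by linarith
    have := (div_pos_iff_of_pos_right hnpos).1 this
    exact_mod_cast this
  have hdn : d < n := by
    have : (d : ℝ) / n < 1 := by linarith
    rw [div_lt_one hnpos] at this
    exact_mod_cast this
  have hHp := (abs_lt.1 (hrp (p + ε₁) (by rw [add_sub_cancel_left, abs_of_pos hε₁]; linarith))).2
  have hHd := (abs_lt.1 (hrq (d / n) (by linarith))).1
  set hp' := binH (p + ε₁)
  set hd' := binH ((d : ℝ) / n)
  have hgap1 : R + hp' + ε₂ - 1 ≤ -(4 * η) := by linarith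
  have hgap0 : R + hp' - 1 ≤ -(4 * η) := by linarith
  have hgap2 : hp' - hd' ≤ -(4 * η) := by linarith
  set x : ℝ := 2 ^ (η * n) with hx_def
  have hx : 0 < x := by positivity
  set V : ℝ := 2 ^ ((n : ℝ) * hp') with hV_def
  have hV : 0 < V := by positivity
  set Sh : ℝ := (n.choose d : ℝ) with hSh_def
  have hSh : 0 < Sh := by
    rw [hSh_def]
    exact_mod_cast Nat.choose_pos hdn.le
  have hShlow : (2 : ℝ) ^ ((n : ℝ) * hd') ≤ (n + 1) * Sh := two_rpow_binH_le_choose hd0 hdn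
  have hx4 : x ^ 4 = 2 ^ (4 * η * n) := by
    rw [hx_def, ← Real.rpow_natCast, ← Real.rpow_mul two_pos.le]
    congr 1
    push_cast
    ring
  have hVSh : V * x ^ 4 ≤ (n + 1) * Sh := by
    refine le_trans ?_ hShlow
    rw [hx4, ← Real.rpow_add two_pos]
    have := mul_le_mul_of_nonneg_left hgap2 hnpos.le
    exact Real.rpow_le_rpow_of_exponent_le one_le_two (by linarith)
  have hMV : M.card * V * x ^ 4 ≤ (n + 1) * Sh := by
    refine le_trans (mul_le_mul_of_nonneg_right (mul_le_mul_of_nonneg_right hM2 hV.le)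
      (by positivity)) (le_trans ?_ hShlow)
    rw [hx4, ← Real.rpow_add two_pos, ← Real.rpow_add two_pos]
    have := mul_le_mul_of_nonneg_left hgap1 hnpos.le
    exact Real.rpow_le_rpow_of_exponent_le one_le_two (by linarith)
  have hceil : ∀ y : ℝ, 0 ≤ y → (⌈(2 : ℝ) ^ y⌉₊ : ℝ) ≤ 2 * 2 ^ y := fun y hy => by
    have h1 := (Nat.ceil_lt_add_one (show (0 : ℝ) ≤ 2 ^ y by positivity)).le
    have h2 := Real.one_le_rpow one_le_two hy
    linarith
  have hNle : (N : ℝ) ≤ 2 * 2 ^ (R * n) := hN ▸ hceil _ (by positivity)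
  have hBle : (B : ℝ) ≤ 2 * x := by
    refine (hB ▸ hceil _ (by positivity)).trans (mul_le_mul_of_nonneg_left ?_ two_pos.le)
    have := mul_le_mul_of_nonneg_left hδ'.2.1 hnpos.le
    exact Real.rpow_le_rpow_of_exponent_le one_le_two (by linarith)
  have hBpos : 0 < B := by
    rw [hB]
    exact Nat.ceil_pos.2 (by positivity)
  have hμ : N * (2 * Sh * V / 2 ^ n) * x ^ 4 ≤ 4 * Sh := by
    have h : (2 : ℝ) ^ (R * n) * V * x ^ 4 ≤ 2 ^ n := by
      rw [hx4, ← Real.rpow_add two_pos, ← Real.rpow_add two_pos, ← Real.rpow_natCast]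
      have := mul_le_mul_of_nonneg_left hgap0 hnpos.le
      exact Real.rpow_le_rpow_of_exponent_le one_le_two (by linarith)
    calc N * (2 * Sh * V / 2 ^ n) * x ^ 4
        ≤ 2 * 2 ^ (R * n) * (2 * Sh * V / 2 ^ n) * x ^ 4 := by gcongr
      _ = 4 * Sh * ((2 : ℝ) ^ (R * n) * V * x ^ 4) / 2 ^ n := by ring
      _ ≤ 4 * Sh := by
          rw [div_le_iff₀ (by positivity)]
          exact mul_le_mul_of_nonneg_left h (by positivity)
  have hbound := shellCode_tail_bound (n := n) (N := N) (ρ := (p + ε₁) * n) (V := V)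
    (t := Sh * (x ^ 2)⁻¹ / 2) (r := (x ^ 2)⁻¹) (thr := 1 ^ 2 * (n : ℝ) ^ 4) (T := n)
    hn0 hdn.le z s M hBpos hV (card_hammingBall_le (by linarith) (by linarith)) (by positivity)
    (by
      have : M.card * V ≤ Sh * (x ^ 2)⁻¹ / 2 := by
        rw [← div_eq_mul_inv, div_div, le_div_iff₀ (by positivity)]
        refine le_of_mul_le_mul_right ?_ (show 0 < x ^ 2 by positivity)
        have hn4 : ((n : ℝ) + 1) * 4 ≤ x ^ 2 :=
          le_trans (mul_le_mul_of_nonneg_left (le_add_of_nonneg_left (by positivity))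
            (by positivity)) hcub
        have hn2 : 2 * ((n : ℝ) + 1) ≤ x ^ 2 := by linarith
        calc M.card * V * (x ^ 2 * 2) * x ^ 2 = 2 * (M.card * V * x ^ 4) := by ring
          _ ≤ 2 * ((n + 1) * Sh) := mul_le_mul_of_nonneg_left hMV two_pos.le
          _ = 2 * (n + 1) * Sh := by ring
          _ ≤ x ^ 2 * Sh := mul_le_mul_of_nonneg_right hn2 hSh.le
          _ = Sh * x ^ 2 := mul_comm _ _
      linarith)
    (by
      rw [one_pow, one_mul]
      exact_mod_cast Nat.le_self_pow (by norm_num) n)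
  refine le_trans (sub_le_sub_left ?_ 1) hbound
  have hNn : (numBlocks M B : ℝ) ≤ 4 * 2 ^ n := by
    have h1 : (numBlocks M B : ℝ) ≤ N + 1 := by exact_mod_cast numBlocks_le M hBpos
    have hR1' : R ≤ 1 := by
      have : 0 ≤ binH p := by
        rw [binH_eq_binEntropy_div]
        exact div_nonneg (Real.binEntropy_nonneg hp0.le (by linarith))
          (Real.log_pos one_lt_two).le
      linarith
    have h2 : (2 : ℝ) ^ (R * n) ≤ 2 ^ n := by
      rw [← Real.rpow_natCast]
      have := mul_le_mul_of_nonneg_left hR1' hnpos.le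
      exact Real.rpow_le_rpow_of_exponent_le one_le_two (by linarith)
    have h3 : (1 : ℝ) ≤ 2 ^ n := one_le_pow₀ one_le_two
    linarith
  have hBr : (B : ℝ) * (x ^ 2)⁻¹ ≤ 2 / x := by
    rw [← div_eq_mul_inv, div_le_div_iff₀ (by positivity) hx]
    exact (mul_le_mul_of_nonneg_right hBle hx.le).trans_eq (by ring)
  have hunion : (numBlocks M B : ℝ) * (B * (x ^ 2)⁻¹) ^ n ≤
      Real.exp (-(η / 4) * (n : ℝ) ^ 2) / 2 :=
    le_trans (by gcongr) (union_bound_exponent_le hn0 h10)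
  have hchernoff := chernoff_exponent_le hnpos hx hV h32 hcub hVSh hSh hμ
  linarith
end

section
/- Let 𝒳 be a finite alphabet and p_X a probability distribution on 𝒳 with Shannon entropy H(p_X) (in bits). For every ε₁ > 0 there exists f(ε₁) ≥ 0 with f(ε₁) → 0 as ε₁ → 0 such that for every c > 0 and every n: (i) if V ⊆ 𝒳^n is a set of ε₁-typical sequences with |V| ≤ 2^{nc}, then the i.i.d. product measure satisfies p_X^{⊗n}(V) ≤ 2^{−n·(H(p_X) − c − f(ε₁))}; and (ii) if moreover 0 < R < H(p_X) − c − f(ε₁), N = ⌈2^{nR}⌉, and X(1), …, X(N) are independent with distribution p_X^{⊗n}, then there is a constant α > 0 such that for all sufficiently large n, Pr( |{w : X(w) ∈ V}| > c·n² ) ≤ e^{−α·n²/6}. -/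
/-!
Generalized counting lemma for typical sets (Lemma 9 of the paper): (i) any set `V` of
ε₁-typical sequences with `|V| ≤ 2^{nc}` has i.i.d. product probability at most
`2^{-n(H(X) - c - f(ε₁))}`, and (ii) if `0 < R < H(X) - c - f(ε₁)` then among `⌈2^{nR}⌉`
i.i.d. `p_X`-distributed codewords, with probability at least `1 - e^{-αn²/6}` at most
`c·n²` of them land in `V`.
-/

open scoped BigOperators Classical

/-- `p` is a probability mass function on the finite type `α`. -/
def IsPMF {α : Type*} [Fintype α] (p : α → ℝ) : Prop :=
  (∀ a, 0 ≤ p a) ∧ ∑ a, p a = 1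

/-- Empirical type of the sequence `x ∈ αⁿ`. -/
noncomputable def empDist {α : Type*} [Fintype α] [DecidableEq α] {n : ℕ}
    (x : Fin n → α) : α → ℝ :=
  fun a => ((Finset.univ.filter fun t => x t = a).card : ℝ) / n

/-- `x` is `ε₁`-typical with respect to `p_X`. -/
def Typical {α : Type*} [Fintype α] [DecidableEq α] (pX : α → ℝ) (ε₁ : ℝ) {n : ℕ}
    (x : Fin n → α) : Prop :=
  ∀ a, |empDist x a - pX a| ≤ ε₁

/-- Shannon entropy (in bits) of a mass function on a finite type. -/
noncomputable def ent {α : Type*} [Fintype α] (P : α → ℝ) : ℝ :=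
  -∑ a, P a * Real.logb 2 (P a)

open Finset in
/-- The product of a weight along a word, grouped by letters, in terms of the empirical type. -/
lemma prod_le_two_rpow_sum_empDist {α : Type*} [Fintype α] [DecidableEq α] (p : α → ℝ)
    (hp : ∀ a, 0 ≤ p a) {n : ℕ} (x : Fin n → α) :
    ∏ t, p (x t) ≤ (2 : ℝ) ^ ((n : ℝ) * ∑ a, empDist x a * Real.logb 2 (p a)) := by
  by_cases h0 : ∃ t, p (x t) = 0
  · obtain ⟨t, ht⟩ := h0
    rw [prod_eq_zero (mem_univ t) ht]
    positivity
  push Not at h0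
  have hsum : (n : ℝ) * ∑ a, empDist x a * Real.logb 2 (p a) = ∑ t, Real.logb 2 (p (x t)) := by
    rw [← sum_fiberwise univ x (fun t => Real.logb 2 (p (x t))), mul_sum]
    refine sum_congr rfl fun a _ => ?_
    rw [sum_congr rfl (g := fun _ => Real.logb 2 (p a))
      (fun t ht => by rw [(mem_filter.mp ht).2]), sum_const, nsmul_eq_mul, empDist]
    rcases Nat.eq_zero_or_pos n with rfl | hn
    · simp
    · have : (n : ℝ) ≠ 0 := by positivity
      field_simp
  rw [hsum, Real.rpow_sum_of_pos (by norm_num)]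
  refine (prod_congr rfl fun t _ => ?_).le
  exact (Real.rpow_logb (by norm_num) (by norm_num) (lt_of_le_of_ne (hp _) (h0 t).symm)).symm

/-- A typical word has probability at most about `2 ^ (-n H)`. -/
lemma Typical.prod_le {α : Type*} [Fintype α] [DecidableEq α] {p : α → ℝ}
    (hp : ∀ a, 0 ≤ p a) {ε : ℝ} {n : ℕ} {x : Fin n → α} (hx : Typical p ε x) :
    ∏ t, p (x t) ≤ (2 : ℝ) ^ (-(n : ℝ) * (ent p - ε * ∑ a, |Real.logb 2 (p a)|)) := by
  refine (prod_le_two_rpow_sum_empDist p hp x).trans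
    (Real.rpow_le_rpow_of_exponent_le (by norm_num) ?_)
  have key : ∑ a, empDist x a * Real.logb 2 (p a) ≤
      ∑ a, (p a * Real.logb 2 (p a) + ε * |Real.logb 2 (p a)|) := by
    refine Finset.sum_le_sum fun a _ => ?_
    have h1 : (empDist x a - p a) * Real.logb 2 (p a) ≤ ε * |Real.logb 2 (p a)| :=
      (le_abs_self _).trans (by
        rw [abs_mul]
        exact mul_le_mul_of_nonneg_right (hx a) (abs_nonneg _))
    linarith
  rw [Finset.sum_add_distrib, ← Finset.mul_sum] at key
  have := mul_le_mul_of_nonneg_left key (Nat.cast_nonneg (α := ℝ) n)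
  rw [ent]
  linarith

/-- A small set of typical words has small probability. -/
lemma sum_prod_le_of_typical {α : Type*} [Fintype α] [DecidableEq α] {p : α → ℝ}
    (hp : ∀ a, 0 ≤ p a) {ε c : ℝ} {n : ℕ} {V : Finset (Fin n → α)}
    (hV : ∀ x ∈ V, Typical p ε x) (hcard : (V.card : ℝ) ≤ (2 : ℝ) ^ ((n : ℝ) * c)) :
    ∑ x ∈ V, ∏ t, p (x t) ≤
      (2 : ℝ) ^ (-(n : ℝ) * (ent p - c - ε * ∑ a, |Real.logb 2 (p a)|)) := by
  refine (Finset.sum_le_card_nsmul V _ _ fun x hx => (hV x hx).prod_le hp).trans ?_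
  rw [nsmul_eq_mul]
  refine (mul_le_mul_of_nonneg_right hcard (by positivity)).trans_eq ?_
  rw [← Real.rpow_add (by norm_num)]
  congr 1
  ring

/-- Chernoff bound: the number of `N` independent samples of `P` that fall into `V` exceeds `s`
with probability at most `exp (N P(V) (e - 1) - s)`. -/
lemma sum_prod_mul_ite_card_le {β : Type*} [Fintype β] {P : β → ℝ} (hP : IsPMF P)
    (V : Finset β) (N : ℕ) (s : ℝ) :
    ∑ C : Fin N → β, (∏ w, P (C w)) *
        (if s < (Nat.card {w : Fin N // C w ∈ V} : ℝ) then (1 : ℝ) else 0)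
      ≤ Real.exp (N * (∑ x ∈ V, P x) * (Real.exp 1 - 1) - s) := by
  have hterm : ∀ C : Fin N → β, (∏ w, P (C w)) *
      (if s < (Nat.card {w : Fin N // C w ∈ V} : ℝ) then (1 : ℝ) else 0) ≤
      Real.exp (-s) * ∏ w, P (C w) * (if C w ∈ V then Real.exp 1 else 1) := by
    intro C
    have hexp : ∏ w, (if C w ∈ V then Real.exp 1 else 1) =
        Real.exp (Nat.card {w : Fin N // C w ∈ V} : ℝ) := by
      rw [Finset.prod_ite, Finset.prod_const, Finset.prod_const_one, mul_one, ← Real.exp_nat_mul,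
        mul_one, Nat.card_eq_fintype_card, Fintype.card_subtype]
    rw [Finset.prod_mul_distrib, hexp, mul_left_comm, ← Real.exp_add]
    refine mul_le_mul_of_nonneg_left ?_ (Finset.prod_nonneg fun w _ => hP.1 _)
    split_ifs with h
    · exact Real.one_le_exp (by linarith)
    · positivity
  have hone : ∑ x, P x * (if x ∈ V then Real.exp 1 else 1) =
      (∑ x ∈ V, P x) * (Real.exp 1 - 1) + 1 := by
    have hsplit : ∀ x, P x * (if x ∈ V then Real.exp 1 else 1) =
        (if x ∈ V then P x * (Real.exp 1 - 1) else 0) + P x := by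
      intro x
      split_ifs <;> ring
    simp only [hsplit, Finset.sum_add_distrib, hP.2, Finset.sum_mul, Finset.sum_ite_mem,
      Finset.univ_inter]
  have hq : 0 ≤ ∑ x ∈ V, P x := Finset.sum_nonneg fun x _ => hP.1 x
  have he : 0 ≤ Real.exp 1 - 1 := by linarith [Real.one_le_exp zero_le_one]
  calc _ ≤ ∑ C : Fin N → β,
        Real.exp (-s) * ∏ w, P (C w) * (if C w ∈ V then Real.exp 1 else 1) :=
        Finset.sum_le_sum fun C _ => hterm C
    _ = Real.exp (-s) * ((∑ x ∈ V, P x) * (Real.exp 1 - 1) + 1) ^ N := by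
        rw [← Finset.mul_sum, ← hone, Fintype.sum_pow]
    _ ≤ Real.exp (-s) * Real.exp ((∑ x ∈ V, P x) * (Real.exp 1 - 1)) ^ N := by
        gcongr
        exact Real.add_one_le_exp _
    _ = _ := by
        rw [← Real.exp_nat_mul, ← Real.exp_add]
        congr 1
        ring

/-- The i.i.d. product of a mass function is a mass function. -/
lemma IsPMF.pi {α : Type*} [Fintype α] [DecidableEq α] {p : α → ℝ} (hp : IsPMF p) (n : ℕ) :
    IsPMF fun x : Fin n → α => ∏ t, p (x t) :=
  ⟨fun x => Finset.prod_nonneg fun t _ => hp.1 _, by rw [← Fintype.sum_pow, hp.2, one_pow]⟩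

/-- **Probability and counting bounds for sets of typical sequences (Lemma 9 of the
paper).** -/
theorem typical_set_counting {𝒳 : Type*} [Fintype 𝒳] [DecidableEq 𝒳]
    (pX : 𝒳 → ℝ) (hpX : IsPMF pX) :
    ∃ f : ℝ → ℝ,
      (∀ ε₁ : ℝ, 0 < ε₁ → 0 ≤ f ε₁) ∧
      Filter.Tendsto f (nhdsWithin 0 (Set.Ioi 0)) (nhds 0) ∧
      (∀ ε₁ : ℝ, 0 < ε₁ → ∀ c : ℝ, 0 < c → ∀ n : ℕ, ∀ V : Finset (Fin n → 𝒳),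
        (∀ x ∈ V, Typical pX ε₁ x) → (V.card : ℝ) ≤ (2 : ℝ) ^ ((n : ℝ) * c) →
        ∑ x ∈ V, ∏ t, pX (x t) ≤ (2 : ℝ) ^ (-(n : ℝ) * (ent pX - c - f ε₁))) ∧
      (∀ ε₁ : ℝ, 0 < ε₁ → ∀ c : ℝ, 0 < c → ∀ R : ℝ, 0 < R → R < ent pX - c - f ε₁ →
        ∃ α : ℝ, 0 < α ∧ ∃ n₀ : ℕ, ∀ n : ℕ, n₀ ≤ n → ∀ V : Finset (Fin n → 𝒳),
          (∀ x ∈ V, Typical pX ε₁ x) → (V.card : ℝ) ≤ (2 : ℝ) ^ ((n : ℝ) * c) →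
          (∑ C : Fin ⌈(2 : ℝ) ^ (R * n)⌉₊ → Fin n → 𝒳,
              (∏ w, ∏ t, pX (C w t)) *
                (if c * (n : ℝ) ^ 2 <
                    (Nat.card {w : Fin ⌈(2 : ℝ) ^ (R * n)⌉₊ // C w ∈ V} : ℝ)
                  then (1 : ℝ) else 0))
            ≤ Real.exp (-α * (n : ℝ) ^ 2 / 6)) := by
  have hK : 0 ≤ ∑ a, |Real.logb 2 (pX a)| := Finset.sum_nonneg fun a _ => abs_nonneg _
  refine ⟨fun ε => ε * ∑ a, |Real.logb 2 (pX a)|, fun ε hε => mul_nonneg hε.le hK, ?_,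
    fun ε _ c _ n V hV hcard => sum_prod_le_of_typical hpX.1 hV hcard, ?_⟩
  · refine Filter.Tendsto.mono_left ?_ nhdsWithin_le_nhds
    exact Continuous.tendsto' (by fun_prop) _ _ (by simp)
  intro ε _ c hc R hR hRlt
  refine ⟨c, hc, ⌈5 / c⌉₊ + 1, fun n hn V hV hcard => ?_⟩
  refine (sum_prod_mul_ite_card_le (hpX.pi n) V _ _).trans (Real.exp_le_exp.mpr ?_)
  have hn1 : (1 : ℝ) ≤ n := by exact_mod_cast (Nat.le_add_left 1 _).trans hn
  have hnc : 5 ≤ c * (n : ℝ) := by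
    have : 5 / c ≤ (n : ℝ) := (Nat.le_ceil _).trans (by exact_mod_cast (Nat.le_succ _).trans hn)
    rw [div_le_iff₀ hc] at this
    linarith
  have hq := sum_prod_le_of_typical hpX.1 hV hcard
  have hN : (⌈(2 : ℝ) ^ (R * n)⌉₊ : ℝ) ≤ 2 * (2 : ℝ) ^ (R * n) := by
    have h1 : (1 : ℝ) ≤ (2 : ℝ) ^ (R * n) :=
      Real.one_le_rpow (by norm_num) (by positivity)
    linarith [Nat.ceil_lt_add_one (zero_le_one.trans h1)]
  have hNq : (⌈(2 : ℝ) ^ (R * n)⌉₊ : ℝ) * ∑ x ∈ V, ∏ t, pX (x t) ≤ 2 := by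
    refine (mul_le_mul hN hq (Finset.sum_nonneg fun x _ => (hpX.pi n).1 x)
      (by positivity)).trans ?_
    rw [mul_assoc, ← Real.rpow_add (by norm_num)]
    have : (2 : ℝ) ^ (R * n + -(n : ℝ) * (ent pX - c - ε * ∑ a, |Real.logb 2 (pX a)|)) ≤ 1 :=
      Real.rpow_le_one_of_one_le_of_nonpos (by norm_num) (by nlinarith)
    linarith
  have he : Real.exp 1 - 1 ≤ 2 := by linarith [Real.exp_one_lt_d9]
  have he0 : 0 ≤ Real.exp 1 - 1 := by linarith [Real.one_le_exp zero_le_one]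
  have hfour := mul_le_mul hNq he he0 zero_le_two
  nlinarith
end
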